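/- Fix K > 0, an integer m ≥ 0, real numbers 0 < a₁, …, aₘ < 1 and 0 < k₁ < ⋯ < kₘ < K, and let Sᵢ = [aᵢ,1] × {kᵢ} ⊂ ℂ. Let D = ((0,1) × (0,K)) ∖ ⋃ᵢ Sᵢ, B = (0,1) × {0}, T = (0,1) × {K}, Γ_D = B ∪ T ∪ ⋃ᵢ Sᵢ and Γ_N = ({0} × (0,K)) ∪ ({1} × ((0,K) ∖ {k₁,…,kₘ})). Fix w ∈ B ∪ T. Suppose P and P̃ are two functions D → ℝ each satisfying: harmonic and strictly positive on D; extending continuously to cl(D) ∖ {w}; extension vanishing on Γ_D ∖ {w}; inner normal derivative existing and equal to 0 at every point of Γ_N; and P(z) − (1/π)·|Im(1/(z − w))| (respectively with P̃) bounded on D ∩ B(w,r) for some r > 0. Then P = P̃ on D. -/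

import Mathlib

open Set Metric Filter Complex Topology

noncomputable section

/-- A function `f : ℂ → ℝ` is harmonic on an open set `U ⊆ ℂ ≅ ℝ²` if it is `C²` there
with vanishing Laplacian. -/
def IsHarmonicOn (f : ℂ → ℝ) (U : Set ℂ) : Prop :=
  ContDiffOn ℝ 2 f U ∧ ∀ z ∈ U,
    (iteratedFDeriv ℝ 2 f z) ![1, 1] + (iteratedFDeriv ℝ 2 f z) ![Complex.I, Complex.I] = 0

/-- The closed horizontal slit `[a,1] × {k}` in `ℂ`. -/
def slitSeg (a k : ℝ) : Set ℂ := {z | a ≤ z.re ∧ z.re ≤ 1 ∧ z.im = k}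

/-- The open unit-width rectangle of height `K` with the horizontal slits removed. -/
def slitRect (K : ℝ) (m : ℕ) (a k : Fin m → ℝ) : Set ℂ :=
  {z | 0 < z.re ∧ z.re < 1 ∧ 0 < z.im ∧ z.im < K} \ ⋃ i, slitSeg (a i) (k i)

/-- The open bottom edge `(0,1) × {0}`. -/
def botEdge : Set ℂ := {z | 0 < z.re ∧ z.re < 1 ∧ z.im = 0}

/-- The open top edge `(0,1) × {K}`. -/
def topEdge (K : ℝ) : Set ℂ := {z | 0 < z.re ∧ z.re < 1 ∧ z.im = K}

/-- Dirichlet part of the boundary: bottom edge, top edge and the slits. -/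
def gammaD (K : ℝ) (m : ℕ) (a k : Fin m → ℝ) : Set ℂ :=
  botEdge ∪ topEdge K ∪ ⋃ i, slitSeg (a i) (k i)

/-- Neumann part of the boundary: the two vertical sides (minus the slit tips on the right). -/
def gammaN (K : ℝ) (m : ℕ) (k : Fin m → ℝ) : Set ℂ :=
  {z | z.re = 0 ∧ 0 < z.im ∧ z.im < K} ∪
    {z | z.re = 1 ∧ 0 < z.im ∧ z.im < K ∧ ∀ i, z.im ≠ k i}

/-- Inner unit normal on the vertical sides: `1` on the left side, `-1` on the right side. -/
def innerNormal (ζ : ℂ) : ℂ := if ζ.re = 0 then 1 else -1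

/-- `P` (with continuous extension `H`) is a Poisson kernel of the slit rectangle with mixed
Dirichlet/Neumann boundary conditions and pole at `w`. -/
def IsMixedPoissonKernel (K : ℝ) (m : ℕ) (a k : Fin m → ℝ) (w : ℂ) (P H : ℂ → ℝ) : Prop :=
  -- (i) harmonic and strictly positive on D
  IsHarmonicOn P (slitRect K m a k) ∧
  (∀ z ∈ slitRect K m a k, 0 < P z) ∧
  -- (ii) continuous extension to cl(D) \ {w}
  ContinuousOn H (closure (slitRect K m a k) \ {w}) ∧
  (∀ z ∈ slitRect K m a k, H z = P z) ∧
  -- (iii) the extension vanishes on Γ_D \ {w}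
  (∀ z ∈ gammaD K m a k \ {w}, H z = 0) ∧
  -- (iv) vanishing inner normal derivative on Γ_N
  (∀ ζ ∈ gammaN K m k,
    Tendsto (fun ε : ℝ => (P (ζ + (ε : ℂ) * innerNormal ζ) - H ζ) / ε)
      (𝓝[>] (0 : ℝ)) (𝓝 0)) ∧
  -- (v) bounded difference with |Im 1/(z-w)|/π near w
  (∃ r > 0, ∃ C : ℝ, ∀ z ∈ slitRect K m a k ∩ ball w r,
    _root_.abs ((P z - (1 / Real.pi) * |(1 / (z - w)).im| : ℝ)) ≤ C)

open InnerProductSpace in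
/-- second derivative test, necessary condition -/
lemma aux_max1d (g g' : ℝ → ℝ) (c : ℝ) (hm : IsLocalMax g 0)
    (h1 : ∀ᶠ t in 𝓝 (0:ℝ), HasDerivAt g (g' t) t) (h2 : HasDerivAt g' c 0) : c ≤ 0 := by
  by_contra hc
  push Not at hc
  have e1 : deriv g =ᶠ[𝓝 0] g' := h1.mono fun t ht => ht.deriv
  have e2 : deriv (deriv g) 0 = c := by rw [e1.deriv_eq, h2.deriv]
  have hmin : IsLocalMin g 0 :=
    isLocalMin_of_deriv_deriv_pos (by rw [e2]; exact hc) hm.deriv_eq_zero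
      h1.self_of_nhds.continuousAt
  have e3 : g =ᶠ[𝓝 0] fun _ => g 0 := by
    filter_upwards [hm, hmin] with t ht ht'
    exact le_antisymm ht ht'
  have e4 : deriv g =ᶠ[𝓝 0] fun _ => 0 := by
    filter_upwards [e3.eventuallyEq_nhds] with t ht
    rw [ht.deriv_eq]; simp
  have e5 : deriv (deriv g) 0 = 0 := by rw [e4.deriv_eq]; simp
  linarith

lemma aux_line (f : ℂ → ℝ) (z e : ℂ) (h : ContDiffAt ℝ 2 f z) :
    (∀ᶠ t : ℝ in 𝓝 (0:ℝ),
      HasDerivAt (fun t : ℝ => f (z + t * e)) (fderiv ℝ f (z + t * e) e) t) ∧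
    HasDerivAt (fun t : ℝ => fderiv ℝ f (z + t * e) e) (iteratedFDeriv ℝ 2 f z ![e, e]) 0 := by
  have hl : ∀ t : ℝ, HasDerivAt (fun t : ℝ => z + (t:ℂ) * e) e t := by
    intro t
    have := ((Complex.ofRealCLM.hasDerivAt (x := t)).mul_const e).const_add z
    simpa using this
  constructor
  · have hc : Tendsto (fun t : ℝ => z + (t:ℂ) * e) (𝓝 0) (𝓝 z) := by
      have := (hl 0).continuousAt.tendsto
      simpa using this
    have := hc.eventually (h.eventually (by simp))
    filter_upwards [this] with t ht
    exact (ht.differentiableAt (by norm_num)).hasFDerivAt.comp_hasDerivAt t (hl t)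
  · have h1 : ContDiffAt ℝ 1 (fderiv ℝ f) z := h.fderiv_right (by norm_num)
    have h2 := (h1.differentiableAt (by norm_num)).hasFDerivAt
    have h3 : HasFDerivAt (fderiv ℝ f) (fderiv ℝ (fderiv ℝ f) z) (z + ((0:ℝ):ℂ) * e) := by
      simpa using h2
    have h4 := h3.comp_hasDerivAt 0 (hl 0)
    rw [iteratedFDeriv_two_apply]
    have h5 := h4.clm_apply (hasDerivAt_const 0 e)
    simpa using h5

open InnerProductSpace in
lemma aux_nomax (h : ℂ → ℝ) (c : ℝ) (hc : 0 < c) (z : ℂ) (hh : HarmonicAt h z)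
    (hm : IsLocalMax (fun z => h z + c * z.im ^ 2) z) : False := by
  have hl : ∀ e : ℂ, Tendsto (fun t : ℝ => z + (t:ℂ) * e) (𝓝 0) (𝓝 z) := by
    intro e
    have : Continuous (fun t : ℝ => z + (t:ℂ) * e) := by fun_prop
    have := this.tendsto 0
    simpa using this
  have hL := hh.2.self_of_nhds
  rw [laplacian_eq_iteratedFDeriv_complexPlane] at hL
  simp only [Pi.zero_apply] at hL
  have hx : iteratedFDeriv ℝ 2 h z ![1, 1] ≤ 0 := by
    obtain ⟨a1, a2⟩ := aux_line h z 1 hh.1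
    refine aux_max1d _ _ _ ?_ a1 a2
    have := (hl 1).eventually hm
    filter_upwards [this] with t ht
    simp at ht ⊢
    exact ht
  have hy : iteratedFDeriv ℝ 2 h z ![I, I] + 2 * c ≤ 0 := by
    obtain ⟨a1, a2⟩ := aux_line h z I hh.1
    refine aux_max1d (fun t : ℝ => h (z + t * I) + c * (z.im + t) ^ 2)
      (fun t : ℝ => fderiv ℝ h (z + t * I) I + c * (2 * (z.im + t))) _ ?_ ?_ ?_
    · have := (hl I).eventually hm
      filter_upwards [this] with t ht
      simp at ht ⊢
      exact ht
    · filter_upwards [a1] with t ht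
      refine ht.add ?_
      have := (((hasDerivAt_id t).const_add z.im).pow 2).const_mul c
      simpa using this
    · refine a2.add ?_
      have := ((((hasDerivAt_id (0:ℝ)).const_add z.im).const_mul 2)).const_mul c
      refine this.congr_deriv ?_
      ring
  linarith

lemma aux_isOpen (K : ℝ) (m : ℕ) (a k : Fin m → ℝ) : IsOpen (slitRect K m a k) := by
  refine IsOpen.sdiff ?_ (isClosed_iUnion_of_finite fun i => ?_)
  · refine (isOpen_lt continuous_const continuous_re).inter
      ((isOpen_lt continuous_re continuous_const).inter
      ((isOpen_lt continuous_const continuous_im).inter (isOpen_lt continuous_im continuous_const)))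
  · exact (isClosed_le continuous_const continuous_re).inter
      ((isClosed_le continuous_re continuous_const).inter
      (isClosed_eq continuous_im continuous_const))

lemma aux_closure (K : ℝ) (m : ℕ) (a k : Fin m → ℝ) :
    closure (slitRect K m a k) ⊆ {z | 0 ≤ z.re ∧ z.re ≤ 1 ∧ 0 ≤ z.im ∧ z.im ≤ K} := by
  refine closure_minimal ?_ ?_
  · rintro z ⟨⟨h1, h2, h3, h4⟩, -⟩
    exact ⟨h1.le, h2.le, h3.le, h4.le⟩
  · exact (isClosed_le continuous_const continuous_re).inter
      ((isClosed_le continuous_re continuous_const).inter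
      ((isClosed_le continuous_const continuous_im).inter
        (isClosed_le continuous_im continuous_const)))

open InnerProductSpace in
lemma aux_harm (f : ℂ → ℝ) (U : Set ℂ) (hU : IsOpen U) (h : IsHarmonicOn f U) (z : ℂ)
    (hz : z ∈ U) : HarmonicAt f z := by
  refine ⟨h.1.contDiffAt (hU.mem_nhds hz), ?_⟩
  filter_upwards [hU.mem_nhds hz] with y hy
  rw [laplacian_eq_iteratedFDeriv_complexPlane]
  exact h.2 y hy

/-- The barrier. -/
def auxPhi (w : ℂ) (C M : ℝ) (z : ℂ) : ℝ :=
  -Real.log ‖z - w‖ + C * ((z.re - 1/2)^2 - 2 * z.im^2) + M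

open InnerProductSpace in
lemma auxPhi_harm (w : ℂ) (C M : ℝ) (z : ℂ) (hz : z ≠ w) :
    HarmonicAt (fun z => auxPhi w C M z + C * z.im ^ 2) z := by
  have h1 : HarmonicAt (fun z : ℂ => Real.log ‖z - w‖) z :=
    AnalyticAt.harmonicAt_log_norm (by fun_prop) (sub_ne_zero.2 hz)
  have h2 : HarmonicAt (fun z : ℂ => ((z - 1/2) ^ 2).re) z :=
    AnalyticAt.harmonicAt_re (by fun_prop)
  have h3 := (h1.neg.add (h2.const_smul (c := C))).add (harmonicAt_const M)
  convert h3 using 1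
  funext y
  simp [auxPhi, pow_two]
  ring

lemma auxPhi_cont (w : ℂ) (C M : ℝ) : ContinuousOn (auxPhi w C M) {w}ᶜ := by
  unfold auxPhi
  refine ContinuousOn.add (ContinuousOn.add (ContinuousOn.neg (ContinuousOn.log ?_ ?_)) ?_) ?_
  · fun_prop
  · intro x hx
    exact norm_ne_zero_iff.2 (sub_ne_zero.2 hx)
  · fun_prop
  · fun_prop

/-- Derivative of the barrier in horizontal directions. -/
lemma auxPhi_deriv (w : ℂ) (C M : ℝ) (z : ℂ) (hz : z ≠ w) (s : ℝ) :
    HasDerivAt (fun t : ℝ => auxPhi w C M (z + t * s))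
      (s * (-(z.re - w.re) / ((z.re - w.re)^2 + (z.im - w.im)^2) + C * (2 * (z.re - 1/2)))) 0 := by
  have hpos : (z.re - w.re)^2 + (z.im - w.im)^2 ≠ 0 := by
    intro h
    apply hz
    apply Complex.ext <;> nlinarith [sq_nonneg (z.re - w.re), sq_nonneg (z.im - w.im)]
  have e : (fun t : ℝ => auxPhi w C M (z + t * s)) = fun t : ℝ =>
      -(Real.log ((z.re + t * s - w.re)^2 + (z.im - w.im)^2) / 2)
        + C * ((z.re + t * s - 1/2)^2 - 2 * z.im^2) + M := by
    funext t
    simp only [auxPhi]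
    rw [Complex.norm_def, Real.log_sqrt (Complex.normSq_nonneg _), Complex.normSq_apply]
    simp
    ring_nf
  rw [e]
  have hb : HasDerivAt (fun t : ℝ => z.re + t * s) s 0 := by
    simpa using ((hasDerivAt_id (0:ℝ)).mul_const s).const_add z.re
  have h1 := ((((hb.sub_const w.re).pow 2).add_const ((z.im - w.im)^2)).log
    (by simpa using hpos)).div_const 2
  have h2 := (((hb.sub_const (1/2)).pow 2).sub_const (2 * z.im^2)).const_mul C
  have h3 := (h1.neg.add h2).add_const M
  refine h3.congr_deriv ?_
  simp only [Pi.pow_apply, zero_mul, add_zero, Nat.cast_ofNat]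
  field_simp
  ring

lemma aux_edge (K : ℝ) (hK : 0 < K) (m : ℕ) (a k : Fin m → ℝ)
    (hk : ∀ i, 0 < k i ∧ k i < K) (z : ℂ) (hz : z ∈ botEdge ∪ topEdge K) :
    z ∈ closure (slitRect K m a k) := by
  obtain ⟨s, hs⟩ : ∃ s : ℝ, ∀ᶠ t : ℝ in 𝓝[>] 0, z + t * (s * I) ∈ slitRect K m a k := by
    have p0 : ∀ᶠ t : ℝ in 𝓝[>] 0, 0 < t := eventually_mem_nhdsWithin
    have p1 : ∀ᶠ t : ℝ in 𝓝[>] 0, t < K := nhdsWithin_le_nhds (eventually_lt_nhds hK)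
    rcases hz with ⟨h1, h2, h3⟩ | ⟨h1, h2, h3⟩
    · refine ⟨1, ?_⟩
      have p2 : ∀ᶠ t : ℝ in 𝓝[>] 0, ∀ i, t < k i :=
        eventually_all.2 fun i => nhdsWithin_le_nhds (eventually_lt_nhds (hk i).1)
      filter_upwards [p0, p1, p2] with t q0 q1 q2
      refine ⟨⟨by simpa using h1, by simpa using h2, by simpa [h3] using q0,
        by simpa [h3] using q1⟩, ?_⟩
      simp only [mem_iUnion, not_exists]
      rintro i ⟨-, -, h⟩
      have := q2 i
      simp [h3] at h
      linarith
    · refine ⟨-1, ?_⟩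
      have p2 : ∀ᶠ t : ℝ in 𝓝[>] 0, ∀ i, t < K - k i :=
        eventually_all.2 fun i => nhdsWithin_le_nhds (eventually_lt_nhds (by linarith [(hk i).2]))
      filter_upwards [p0, p1, p2] with t q0 q1 q2
      refine ⟨⟨by simpa using h1, by simpa using h2, by simpa [h3] using q1,
        by simpa [h3] using q0⟩, ?_⟩
      simp only [mem_iUnion, not_exists]
      rintro i ⟨-, -, h⟩
      have := q2 i
      simp [h3] at h
      linarith
  refine mem_closure_of_tendsto (f := fun t : ℝ => z + t * (s * I)) (b := 𝓝[>] 0) ?_ hs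
  have : Continuous (fun t : ℝ => z + (t:ℂ) * (s * I)) := by fun_prop
  have := this.tendsto 0
  simp only [ofReal_zero, zero_mul, add_zero] at this
  exact this.mono_left nhdsWithin_le_nhds

lemma aux_corner (K : ℝ) (hK : 0 < K) (m : ℕ) (a k : Fin m → ℝ)
    (hk : ∀ i, 0 < k i ∧ k i < K) (w : ℂ) (H : ℂ → ℝ)
    (hc : ContinuousOn H (closure (slitRect K m a k) \ {w}))
    (h0 : ∀ z ∈ gammaD K m a k \ {w}, H z = 0) (z : ℂ) (hz : z ∈ closure (slitRect K m a k))
    (hzw : z ≠ w) (him : z.im = 0 ∨ z.im = K) : H z = 0 := by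
  have hsub : (botEdge ∪ topEdge K) \ {w} ⊆ closure (slitRect K m a k) \ {w} :=
    fun y hy => ⟨aux_edge K hK m a k hk y hy.1, hy.2⟩
  have hcl : z ∈ closure ((botEdge ∪ topEdge K) \ {w}) := by
    have : Continuous (fun t : ℝ => z + (t:ℂ) * ((1/2 - z.re : ℝ) : ℂ)) := by fun_prop
    have := this.tendsto 0
    simp only [ofReal_zero, zero_mul, add_zero] at this
    have ht := this.mono_left (nhdsWithin_le_nhds (s := Ioi 0))
    refine mem_closure_of_tendsto ht ?_
    have p0 : ∀ᶠ t : ℝ in 𝓝[>] 0, 0 < t := eventually_mem_nhdsWithin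
    have p1 : ∀ᶠ t : ℝ in 𝓝[>] 0, t < 1 := nhdsWithin_le_nhds (eventually_lt_nhds one_pos)
    have p2 := ht.eventually (isOpen_ne.mem_nhds hzw)
    obtain ⟨r1, r2, -, -⟩ := aux_closure K m a k hz
    filter_upwards [p0, p1, p2] with t q0 q1 q2
    refine ⟨?_, q2⟩
    have e1 : 0 < z.re + t * (1/2 - z.re) := by nlinarith
    have e2 : z.re + t * (1/2 - z.re) < 1 := by nlinarith
    have er : (z + (t:ℂ) * ((1/2 - z.re : ℝ) : ℂ)).re = z.re + t * (1/2 - z.re) := by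
      rw [add_re, re_ofReal_mul, ofReal_re]
    have ei : (z + (t:ℂ) * ((1/2 - z.re : ℝ) : ℂ)).im = z.im := by
      rw [add_im, im_ofReal_mul, ofReal_im]; ring
    rcases him with h | h
    · exact Or.inl ⟨er ▸ e1, er ▸ e2, ei.trans h⟩
    · exact Or.inr ⟨er ▸ e1, er ▸ e2, ei.trans h⟩
  have h1 := ((hc z ⟨hz, hzw⟩).mono hsub).mem_closure_image hcl
  have h2 : H '' ((botEdge ∪ topEdge K) \ {w}) ⊆ {0} := by
    rintro _ ⟨y, hy, rfl⟩
    exact h0 y ⟨Or.inl hy.1, hy.2⟩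
  have h3 := closure_mono h2 h1
  simpa using h3

/-- One-sided comparison up to a multiple of the barrier. -/
lemma aux_main (K : ℝ) (hK : 0 < K) (m : ℕ) (a k : Fin m → ℝ)
    (ha : ∀ i, 0 < a i ∧ a i < 1) (hk : ∀ i, 0 < k i ∧ k i < K)
    (w : ℂ) (hw : w ∈ botEdge ∪ topEdge K) (P P' H H' : ℂ → ℝ)
    (hP : IsMixedPoissonKernel K m a k w P H)
    (hP' : IsMixedPoissonKernel K m a k w P' H') (C M : ℝ)
    (hC : C = 1 / w.re + 1 / (1 - w.re) + 1) (hM : M = K + 2 * C * K ^ 2)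
    (ε : ℝ) (hε : 0 < ε) (z0 : ℂ) (hz0 : z0 ∈ slitRect K m a k) :
    P z0 - P' z0 ≤ ε * auxPhi w C M z0 := by
  obtain ⟨hh, -, hc, he, hd, hn, r, hr, C1, hb⟩ := hP
  obtain ⟨hh', -, hc', he', hd', hn', r', hr', C2, hb'⟩ := hP'
  have hwr : 0 < w.re ∧ w.re < 1 := by
    rcases hw with h | h <;> exact ⟨h.1, h.2.1⟩
  have hwi : w.im = 0 ∨ w.im = K := by
    rcases hw with h | h
    · exact Or.inl h.2.2
    · exact Or.inr h.2.2
  have i1 : 0 < 1 / w.re := by have := hwr.1; positivity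
  have i2 : 0 < 1 / (1 - w.re) := by have : 0 < 1 - w.re := by linarith [hwr.2]
                                     positivity
  have hCpos : 0 < C := by rw [hC]; positivity
  have hwD : w ∉ slitRect K m a k := by
    rintro ⟨⟨-, -, h3, h4⟩, -⟩
    rcases hwi with h | h <;> linarith
  have hDw : ∀ z ∈ slitRect K m a k, z ≠ w := fun z hz h => hwD (h ▸ hz)
  have hphi1 : ∀ z ∈ closure (slitRect K m a k), -Real.log ‖z - w‖ + K ≤ auxPhi w C M z := by
    intro z hz
    obtain ⟨r1, r2, r3, r4⟩ := aux_closure K m a k hz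
    have : z.im ^ 2 ≤ K ^ 2 := by nlinarith
    have : C * z.im ^ 2 ≤ C * K ^ 2 := by gcongr
    have : 0 ≤ C * (z.re - 1/2) ^ 2 := by positivity
    unfold auxPhi
    rw [hM]
    linarith
  have hphi0 : ∀ z ∈ closure (slitRect K m a k), z ≠ w → 0 ≤ auxPhi w C M z := by
    intro z hz hzw
    refine le_trans ?_ (hphi1 z hz)
    obtain ⟨r1, r2, r3, r4⟩ := aux_closure K m a k hz
    have n1 : 0 < ‖z - w‖ := norm_pos_iff.2 (sub_ne_zero.2 hzw)
    have n2 := Real.log_le_sub_one_of_pos n1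
    have n3 := Complex.norm_le_abs_re_add_abs_im (z - w)
    have n4 : |(z - w).re| ≤ 1 := by
      rw [sub_re, abs_le]; constructor <;> linarith [hwr.1, hwr.2]
    have n5 : |(z - w).im| ≤ K := by
      rw [sub_im, abs_le]; rcases hwi with h | h <;> rw [h] <;> constructor <;> linarith
    linarith
  set v : ℂ → ℝ := fun z => H z - H' z - ε * auxPhi w C M z with hv
  obtain ⟨ρ, hρ, hnear⟩ : ∃ ρ > 0, ∀ z ∈ slitRect K m a k ∩ ball w ρ, v z ≤ 0 := by
    refine ⟨min (min r r') (Real.exp (-(C1 + C2) / ε)),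
      lt_min (lt_min hr hr') (Real.exp_pos _), ?_⟩
    rintro z ⟨hz, hzb⟩
    rw [mem_ball, lt_min_iff, lt_min_iff] at hzb
    obtain ⟨⟨b1, b2⟩, b3⟩ := hzb
    have c1 := abs_le.1 (hb z ⟨hz, b1⟩)
    have c2 := abs_le.1 (hb' z ⟨hz, b2⟩)
    rw [dist_eq_norm] at b3
    have n1 : 0 < ‖z - w‖ := norm_pos_iff.2 (sub_ne_zero.2 (hDw z hz))
    have l1 : Real.log ‖z - w‖ < -(C1 + C2) / ε := (Real.log_lt_iff_lt_exp n1).2 b3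
    have l2 : (C1 + C2) / ε ≤ auxPhi w C M z := by
      have := hphi1 z (subset_closure hz)
      rw [neg_div] at l1
      linarith
    have l3 : C1 + C2 ≤ ε * auxPhi w C M z := by
      rw [div_le_iff₀ hε] at l2; linarith
    simp only [hv]
    rw [he z hz, he' z hz]
    linarith [c1.2, c2.1]
  by_contra hcon
  push Not at hcon
  have hv0 : 0 < v z0 := by simp only [hv]; rw [he z0 hz0, he' z0 hz0]; linarith
  have hz0S : z0 ∈ closure (slitRect K m a k) \ ball w ρ :=
    ⟨subset_closure hz0, fun h => absurd (hnear z0 ⟨hz0, h⟩) (not_le.2 hv0)⟩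
  have hSw : ∀ z ∈ closure (slitRect K m a k) \ ball w ρ, z ≠ w := by
    rintro z ⟨-, h⟩ rfl
    exact h (mem_ball_self hρ)
  have hcomp : IsCompact (closure (slitRect K m a k) \ ball w ρ) := by
    refine IsCompact.of_isClosed_subset
      ((isCompact_Icc (a := (0:ℝ)) (b := 1)).reProdIm (isCompact_Icc (a := (0:ℝ)) (b := K)))
      (isClosed_closure.sdiff isOpen_ball) ?_
    rintro z ⟨hz, -⟩
    obtain ⟨r1, r2, r3, r4⟩ := aux_closure K m a k hz
    exact ⟨⟨r1, r2⟩, ⟨r3, r4⟩⟩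
  have hvc : ContinuousOn v (closure (slitRect K m a k) \ ball w ρ) := by
    have hs : closure (slitRect K m a k) \ ball w ρ ⊆ closure (slitRect K m a k) \ {w} :=
      fun z hz => ⟨hz.1, hSw z hz⟩
    exact ((hc.mono hs).sub (hc'.mono hs)).sub
      (continuousOn_const.mul ((auxPhi_cont w C M).mono fun z hz => hSw z hz))
  obtain ⟨z1, hz1, hmax⟩ := hcomp.exists_isMaxOn ⟨z0, hz0S⟩ hvc
  have hv1 : 0 < v z1 := lt_of_lt_of_le hv0 (hmax hz0S)
  have hmaxD : ∀ z ∈ slitRect K m a k, v z ≤ v z1 := by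
    intro z hz
    by_cases h : z ∈ ball w ρ
    · exact (hnear z ⟨hz, h⟩).trans hv1.le
    · exact hmax ⟨subset_closure hz, h⟩
  have hz1w := hSw z1 hz1
  have hphiz1 := hphi0 z1 hz1.1 hz1w
  have hne : ¬ (H z1 = 0 ∧ H' z1 = 0) := by
    rintro ⟨h1, h2⟩
    simp only [hv, h1, h2] at hv1
    nlinarith
  obtain ⟨r1, r2, r3, r4⟩ := aux_closure K m a k hz1.1
  have him : z1.im ≠ 0 ∧ z1.im ≠ K := by
    constructor <;> intro h <;> apply hne
    · exact ⟨aux_corner K hK m a k hk w H hc hd z1 hz1.1 hz1w (Or.inl h),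
        aux_corner K hK m a k hk w H' hc' hd' z1 hz1.1 hz1w (Or.inl h)⟩
    · exact ⟨aux_corner K hK m a k hk w H hc hd z1 hz1.1 hz1w (Or.inr h),
        aux_corner K hK m a k hk w H' hc' hd' z1 hz1.1 hz1w (Or.inr h)⟩
  have him0 : 0 < z1.im := lt_of_le_of_ne r3 (Ne.symm him.1)
  have himK : z1.im < K := lt_of_le_of_ne r4 him.2
  have hslit : z1 ∉ ⋃ i, slitSeg (a i) (k i) := fun h =>
    hne ⟨hd z1 ⟨Or.inr h, hz1w⟩, hd' z1 ⟨Or.inr h, hz1w⟩⟩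
  -- the Neumann sides
  have hneu : ∀ s : ℝ, innerNormal z1 = s → z1 ∈ gammaN K m k →
      (∀ᶠ t : ℝ in 𝓝[>] 0, z1 + t * (s:ℂ) ∈ slitRect K m a k) →
      0 ≤ s * (-(z1.re - w.re) / ((z1.re - w.re)^2 + (z1.im - w.im)^2)
        + C * (2 * (z1.re - 1/2))) := by
    intro s hs hN hin
    have t1 := hn z1 hN
    have t2 := hn' z1 hN
    have t3 := (hasDerivAt_iff_tendsto_slope_zero.1 (auxPhi_deriv w C M z1 hz1w s)).mono_left
      (nhdsWithin_mono 0 (fun x (hx : 0 < x) => ne_of_gt hx))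
    have t4 := (t1.sub t2).sub (t3.const_mul ε)
    have t5 := le_of_tendsto t4 (b := 0) (by
      filter_upwards [hin, eventually_mem_nhdsWithin] with t ht ht0
      have ht0' : 0 < t := ht0
      have := hmaxD _ ht
      simp only [hv] at this
      rw [he _ ht, he' _ ht] at this
      rw [hs]
      simp only [zero_add, ofReal_zero, zero_mul, add_zero, smul_eq_mul]
      have e : (P (z1 + t * (s:ℂ)) - H z1) / t - (P' (z1 + t * (s:ℂ)) - H' z1) / t
          - ε * (t⁻¹ * (auxPhi w C M (z1 + t * (s:ℂ)) - auxPhi w C M z1))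
          = ((P (z1 + t * (s:ℂ)) - P' (z1 + t * (s:ℂ)) - ε * auxPhi w C M (z1 + t * (s:ℂ)))
            - (H z1 - H' z1 - ε * auxPhi w C M z1)) / t := by
        field_simp
        ring
      rw [e]
      exact div_nonpos_of_nonpos_of_nonneg (by linarith) ht0'.le)
    nlinarith
  have p0 : ∀ᶠ t : ℝ in 𝓝[>] 0, 0 < t := eventually_mem_nhdsWithin
  have p1 : ∀ᶠ t : ℝ in 𝓝[>] 0, t < 1 := nhdsWithin_le_nhds (eventually_lt_nhds one_pos)
  have hfrac : ∀ x y : ℝ, 0 < x → x / (x ^ 2 + y ^ 2) ≤ 1 / x := by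
    intro x y hx
    rw [div_le_div_iff₀ (by positivity) hx]
    nlinarith [sq_nonneg y]
  rcases r1.eq_or_lt with hre0 | hre0
  · have p2 : ∀ᶠ t : ℝ in 𝓝[>] 0, ∀ i, t < a i :=
      eventually_all.2 fun i => nhdsWithin_le_nhds (eventually_lt_nhds (ha i).1)
    have := hneu 1 (by simp [innerNormal, ← hre0]) (Or.inl ⟨hre0.symm, him0, himK⟩) (by
      filter_upwards [p0, p1, p2] with t q0 q1 q2
      refine ⟨⟨by simpa [← hre0] using q0, by simpa [← hre0] using q1, by simpa using him0,
        by simpa using himK⟩, ?_⟩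
      simp only [mem_iUnion, not_exists]
      rintro i ⟨h, -, -⟩
      have := q2 i
      simp [← hre0] at h
      linarith)
    rw [← hre0] at this
    have f := hfrac w.re (z1.im - w.im) hwr.1
    have e : -(0 - w.re) / ((0 - w.re)^2 + (z1.im - w.im)^2)
      = w.re / (w.re^2 + (z1.im - w.im)^2) := by ring_nf
    rw [e] at this
    linarith
  rcases r2.eq_or_lt with hre1 | hre1
  · have hki : ∀ i, z1.im ≠ k i := fun i h =>
      hslit (mem_iUnion.2 ⟨i, by rw [hre1]; exact (ha i).2.le, hre1.le, h⟩)
    have := hneu (-1) (by simp [innerNormal, hre1]) (Or.inr ⟨hre1, him0, himK, hki⟩) (by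
      filter_upwards [p0, p1] with t q0 q1
      refine ⟨⟨by simpa [hre1] using q1, by simpa [hre1] using q0, by simpa using him0,
        by simpa using himK⟩, ?_⟩
      simp only [mem_iUnion, not_exists]
      rintro i ⟨-, -, h⟩
      exact hki i (by simpa using h))
    rw [hre1] at this
    have f := hfrac (1 - w.re) (z1.im - w.im) (by linarith [hwr.2])
    have e : -(1 - w.re) / ((1 - w.re)^2 + (z1.im - w.im)^2)
      = -((1 - w.re) / ((1 - w.re)^2 + (z1.im - w.im)^2)) := by ring
    rw [e] at this
    linarith
  -- interior
  have hopen := aux_isOpen K m a k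
  have hz1D : z1 ∈ slitRect K m a k := ⟨⟨hre0, hre1, him0, himK⟩, hslit⟩
  have hharm := ((aux_harm P _ hopen hh z1 hz1D).sub (aux_harm P' _ hopen hh' z1 hz1D)).sub
    ((auxPhi_harm w C M z1 hz1w).const_smul (c := ε))
  refine aux_nomax _ (ε * C) (by positivity) z1 hharm ?_
  filter_upwards [hopen.mem_nhds hz1D] with z hz
  have := hmaxD z hz
  simp only [hv] at this
  rw [he _ hz, he' _ hz, he _ hz1D, he' _ hz1D] at this
  simp only [Pi.sub_apply, Pi.smul_apply, smul_eq_mul]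
  linarith

lemma aux_le (K : ℝ) (hK : 0 < K) (m : ℕ) (a k : Fin m → ℝ)
    (ha : ∀ i, 0 < a i ∧ a i < 1) (hk : ∀ i, 0 < k i ∧ k i < K)
    (w : ℂ) (hw : w ∈ botEdge ∪ topEdge K) (P P' H H' : ℂ → ℝ)
    (hP : IsMixedPoissonKernel K m a k w P H)
    (hP' : IsMixedPoissonKernel K m a k w P' H') (z : ℂ) (hz : z ∈ slitRect K m a k) :
    P z ≤ P' z := by
  have h := fun ε hε => aux_main K hK m a k ha hk w hw P P' H H' hP hP' _ _ rfl rfl ε hε z hz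
  set φ := auxPhi w (1 / w.re + 1 / (1 - w.re) + 1)
    (K + 2 * (1 / w.re + 1 / (1 - w.re) + 1) * K ^ 2) z
  have ht : Tendsto (fun ε : ℝ => ε * φ) (𝓝[>] 0) (𝓝 0) := by
    have : Continuous (fun ε : ℝ => ε * φ) := by fun_prop
    have := this.tendsto 0
    simp only [zero_mul] at this
    exact this.mono_left nhdsWithin_le_nhds
  have := ge_of_tendsto ht (b := P z - P' z)
    (by filter_upwards [eventually_mem_nhdsWithin] with ε hε using h ε hε)
  linarith

/-- Uniqueness of the Poisson kernel of the slit rectangle with mixed boundary conditions. -/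
theorem slit_poisson_unique (K : ℝ) (hK : 0 < K) (m : ℕ) (a k : Fin m → ℝ)
    (ha : ∀ i, 0 < a i ∧ a i < 1) (hk : ∀ i, 0 < k i ∧ k i < K) (hmono : StrictMono k)
    (w : ℂ) (hw : w ∈ botEdge ∪ topEdge K) (P P' H H' : ℂ → ℝ)
    (hP : IsMixedPoissonKernel K m a k w P H)
    (hP' : IsMixedPoissonKernel K m a k w P' H') :
    Set.EqOn P P' (slitRect K m a k) := by
  intro z hz
  exact le_antisymm (aux_le K hK m a k ha hk w hw P P' H H' hP hP' z hz)
    (aux_le K hK m a k ha hk w hw P' P H' H hP' hP z hz)
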